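/- arXiv:2308.05265 — 4 statements merged into one kernel-verified Lean document; each statement's English description precedes it below -/
import Mathlib

section
/- For any 0 ≤ v ≤ 1, C ≥ 0, 0 ≤ α ≤ 1, and ṽ > 0, the map x ↦ x − d̃(x, x; v, C, α, ṽ) = x − min{v·x, ξ(x; C, α, ṽ)} is nondecreasing on ℝ. -/
/-- Capacity term with capacity drop: `ξ(z; C, α, ṽ) = C` if `z ≤ C/ṽ`, else `α·C`. -/
noncomputable def xi (z C α vt : ℝ) : ℝ := if z ≤ C / vt then C else α * C

/-- The capacity term is nonincreasing in the occupancy. -/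
theorem antitone_xi {C α : ℝ} (hC : 0 ≤ C) (hα : α ≤ 1) (vt : ℝ) :
    Antitone (fun z => xi z C α vt) := by
  intro x y hxy
  have hdrop : α * C ≤ C := mul_le_of_le_one_left hC hα
  dsimp only [xi]
  split_ifs <;> linarith

/-- For `0 ≤ v ≤ 1`, `C ≥ 0`, `0 ≤ α ≤ 1`, `ṽ > 0`, the map
`x ↦ x − min{v·x, ξ(x; C, α, ṽ)}` is nondecreasing on `ℝ`. -/
theorem occupancy_minus_demand_monotone (v C α vt : ℝ)
    (hv0 : 0 ≤ v) (hv1 : v ≤ 1) (hC : 0 ≤ C) (hα0 : 0 ≤ α) (hα1 : α ≤ 1) (hvt : 0 < vt) :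
    Monotone (fun x : ℝ => x - min (v * x) (xi x C α vt)) := by
  intro x y hxy
  have hxi : xi y C α vt ≤ xi x C α vt := antitone_xi hC hα1 vt hxy
  have hvxy : v * (y - x) ≤ y - x := mul_le_of_le_one_left (sub_nonneg.2 hxy) hv1
  have hmin : min (v * y) (xi y C α vt) ≤ min (v * x) (xi x C α vt) + (y - x) := by
    rw [← min_add_add_right]
    exact min_le_min (by linarith) (by linarith)
  dsimp only
  linarith
end

section
/- For any 0 ≤ w ≤ 1, xjam ∈ ℝ, and K ∈ ℝ, the map x ↦ x + max{0, min{w·(xjam − x), K}} is nondecreasing on ℝ. -/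
/-- For `0 ≤ w ≤ 1`, the map `x ↦ x + max{0, min{w·(xjam − x), K}}` is nondecreasing on `ℝ`. -/
theorem occupancy_plus_supply_monotone (w xjam K : ℝ) (hw0 : 0 ≤ w) (hw1 : w ≤ 1) :
    Monotone (fun x : ℝ => x + max 0 (min (w * (xjam - x)) K)) := by
  intro x y hxy
  have hflow : w * (xjam - x) ≤ w * (xjam - y) + (y - x) := by
    linarith [mul_le_mul_of_nonneg_right hw1 (sub_nonneg.mpr hxy)]
  have hmin : min (w * (xjam - x)) K ≤ min (w * (xjam - y)) K + (y - x) := by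
    rw [← min_add_add_right]
    exact min_le_min hflow (by linarith)
  have hmax : max 0 (min (w * (xjam - x)) K) ≤
      max 0 (min (w * (xjam - y)) K) + (y - x) := by
    rw [← max_add_add_right]
    exact max_le_max (by linarith) hmin
  change x + max 0 (min (w * (xjam - x)) K) ≤ y + max 0 (min (w * (xjam - y)) K)
  linarith
end

section
/- Let v ≥ 0 and w ≥ 0 satisfy v + w ≤ 1, let β ∈ (0, 1], xjam ∈ ℝ, K ≥ 0, A ∈ ℝ, B ∈ ℝ, C ≥ 0, 0 ≤ α ≤ 1, and ṽ > 0. Then the map x ↦ x + β·min{A, max{0, min{(w/β)·(xjam − x), K}}} − min{ min{v·x, ξ(x; C, α, ṽ)}, B } is nondecreasing on ℝ. -/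
/-- `xi` is nonincreasing in its first argument. -/
theorem xi_antitone {C α : ℝ} (vt : ℝ) (hC : 0 ≤ C) (hα1 : α ≤ 1) :
    Antitone (fun z : ℝ => xi z C α vt) := by
  intro x y hxy
  have hdrop : α * C ≤ C := mul_le_of_le_one_left hC hα1
  simp only [xi]
  split_ifs <;> linarith

/-- Truncating from above and below preserves a one-sided bound on a decrease. -/
theorem min_max_min_le_add {a b d : ℝ} (A K : ℝ) (hd : 0 ≤ d) (hab : a ≤ b + d) :
    min A (max 0 (min a K)) ≤ min A (max 0 (min b K)) + d := by
  have hmin : min a K ≤ min b K + d := by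
    rw [← min_add_add_right]
    exact min_le_min hab (le_add_of_nonneg_right hd)
  rw [← min_add_add_right, ← max_add_add_right]
  exact min_le_min (le_add_of_nonneg_right hd)
    (max_le_max (by simpa using hd) hmin)

/-- The outflow grows at rate at most `v`. -/
theorem outflow_le_add {v C α x y : ℝ} (vt B : ℝ) (hv : 0 ≤ v) (hC : 0 ≤ C) (hα1 : α ≤ 1)
    (hxy : x ≤ y) :
    min (min (v * y) (xi y C α vt)) B ≤
      min (min (v * x) (xi x C α vt)) B + v * (y - x) := by
  have hd : 0 ≤ v * (y - x) := mul_nonneg hv (sub_nonneg.mpr hxy)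
  have hxi : xi y C α vt ≤ xi x C α vt := xi_antitone vt hC hα1 hxy
  rw [← min_add_add_right, ← min_add_add_right]
  exact min_le_min (min_le_min (by linarith) (by linarith)) (by linarith)

/-- The inflow decreases at rate at most `w`. -/
theorem inflow_le_add {w β x y : ℝ} (xjam K A : ℝ) (hw : 0 ≤ w) (hβ0 : 0 < β) (hxy : x ≤ y) :
    β * min A (max 0 (min ((w / β) * (xjam - x)) K)) ≤
      β * min A (max 0 (min ((w / β) * (xjam - y)) K)) + w * (y - x) := by
  have hd : 0 ≤ w / β * (y - x) := mul_nonneg (by positivity) (sub_nonneg.mpr hxy)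
  have h := min_max_min_le_add (a := w / β * (xjam - x)) (b := w / β * (xjam - y)) A K hd
    (by linarith)
  calc _ ≤ β * (min A (max 0 (min ((w / β) * (xjam - y)) K)) + w / β * (y - x)) :=
        mul_le_mul_of_nonneg_left h hβ0.le
    _ = _ := by field_simp

/-- Own-variable monotonicity of one component of the mixed-monotone CTM embedding:
for `v, w ≥ 0` with `v + w ≤ 1`, `β ∈ (0,1]`, `K ≥ 0`, `C ≥ 0`, `0 ≤ α ≤ 1`, `ṽ > 0`,
the map `x ↦ x + β·min{A, max{0, min{(w/β)·(xjam − x), K}}} − min{min{v·x, ξ(x)}, B}`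
is nondecreasing on `ℝ`. -/
theorem own_variable_monotone (v w β xjam K A B C α vt : ℝ)
    (hv : 0 ≤ v) (hw : 0 ≤ w) (hvw : v + w ≤ 1) (hβ0 : 0 < β) (hβ1 : β ≤ 1)
    (hK : 0 ≤ K) (hC : 0 ≤ C) (hα0 : 0 ≤ α) (hα1 : α ≤ 1) (hvt : 0 < vt) :
    Monotone (fun x : ℝ =>
      x + β * min A (max 0 (min ((w / β) * (xjam - x)) K))
        - min (min (v * x) (xi x C α vt)) B) := by
  intro x y hxy
  have hin := inflow_le_add xjam K A hw hβ0 hxy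
  have hout := outflow_le_add (v := v) vt B hv hC hα1 hxy
  have hcfl : (v + w) * (y - x) ≤ y - x :=
    mul_le_of_le_one_left (sub_nonneg.mpr hxy) hvw
  dsimp only
  linarith
end

section
/- (Proposition 1, property M2.) Let θ, θ̃, η be admissible parameter vectors such that for every cell i the CFL-type pairing bounds v_i(η) + w_i(θ) ≤ 1 and v_i(η) + w_i(θ̃) ≤ 1 hold. Let x, x̃, z ∈ ℝ^{2I} with x, x̃ componentwise nonnegative, u ∈ ℝ^I, and λ, λ̃, φ ∈ ℝ^I. If x ≤ x̃, λ ≤ λ̃, and θ ≤ θ̃ (componentwise in all parameter components), then F(x, z, u, λ, φ; θ, η) ≤ F(x̃, z, u, λ̃, φ; θ̃, η) componentwise. -/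
/-- CTM parameter vector: for each cell `i` (0-based, `i < I`), free-flow speed `v i`,
congestion-wave speed `w i`, capacity `C i`, capacity-drop factor `α i`, mainline
split ratio `β i`, and jam occupancy `xjam i`. -/
structure CTMParams where
  v : ℕ → ℝ
  w : ℕ → ℝ
  C : ℕ → ℝ
  α : ℕ → ℝ
  β : ℕ → ℝ
  xjam : ℕ → ℝ

/-- Admissibility: `v i > 0`, `w i > 0`, `C i > 0`, `α i ∈ (0,1]`, `β i ∈ (0,1]`,
`xjam i > 0` for every cell `i < I`. -/
def CTMParams.Admissible (I : ℕ) (θ : CTMParams) : Prop :=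
  ∀ i < I, 0 < θ.v i ∧ 0 < θ.w i ∧ 0 < θ.C i ∧
    (0 < θ.α i ∧ θ.α i ≤ 1) ∧ (0 < θ.β i ∧ θ.β i ≤ 1) ∧ 0 < θ.xjam i

/-- Componentwise order on parameter vectors (in all parameter components, for all cells). -/
def CTMParams.Le (I : ℕ) (θ θ' : CTMParams) : Prop :=
  ∀ i < I, θ.v i ≤ θ'.v i ∧ θ.w i ≤ θ'.w i ∧ θ.C i ≤ θ'.C i ∧
    θ.α i ≤ θ'.α i ∧ θ.β i ≤ θ'.β i ∧ θ.xjam i ≤ θ'.xjam i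

/-- Decomposed demand of cell `i`:
`d̃_i(x, z; θ, θ') = min{v_i x, ξ(z; C_i, α_i, v'_i)}` with `v, C, α` from `θ`, `v'` from `θ'`. -/
noncomputable def dtil (θ θ' : CTMParams) (i : ℕ) (x z : ℝ) : ℝ :=
  min (θ.v i * x) (xi z (θ.C i) (θ.α i) (θ'.v i))

/-- Decomposed supply of cell `i ≥ 1`:
`s̃_i(x; θ, θ') = max{0, min{(w_i/β'_{i−1})(xjam_i − x), C_{i−1}}}`
with `w, xjam, C` from `θ`, `β'` from `θ'`. -/
noncomputable def stil (θ θ' : CTMParams) (i : ℕ) (x : ℝ) : ℝ :=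
  max 0 (min ((θ.w i / θ'.β (i - 1)) * (θ.xjam i - x)) (θ.C (i - 1)))

/-- True demand `d_i(x; θ) = d̃_i(x, x; θ, θ)`. -/
noncomputable def ctmDem (θ : CTMParams) (i : ℕ) (x : ℝ) : ℝ := dtil θ θ i x x

/-- True supply `s_i(x; θ) = s̃_i(x; θ, θ)`. -/
noncomputable def ctmSup (θ : CTMParams) (i : ℕ) (x : ℝ) : ℝ := stil θ θ i x

/-- CTM dynamics `f(x, u, λ; θ)` with `I` cells (0-based); components `0 ≤ i < I` are
mainline cells, components `I ≤ i < 2I` are on-ramp queues. -/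
noncomputable def ctmF (I : ℕ) (θ : CTMParams) (x u lam : ℕ → ℝ) : ℕ → ℝ := fun i =>
  if i < I then
    x i + (u i + (if i = 0 then 0 else
        θ.β (i - 1) * min (ctmDem θ (i - 1) (x (i - 1))) (ctmSup θ i (x i))))
      - (if i = I - 1 then ctmDem θ i (x i)
         else min (ctmDem θ i (x i)) (ctmSup θ (i + 1) (x (i + 1))))
  else if i < 2 * I then
    x i + lam (i - I) - u (i - I)
  else 0

/-- Mixed-monotone embedding map `F(x̄, x̲, u, λ̄, λ̲; θ̄, θ̲)` for the CTM with `I` cells. -/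
noncomputable def ctmEmb (I : ℕ) (xu xl : ℕ → ℝ) (u lamu _laml : ℕ → ℝ)
    (θu θl : CTMParams) : ℕ → ℝ := fun i =>
  if i < I then
    xu i + (u i + (if i = 0 then 0 else
        θu.β (i - 1) * min (dtil θu θl (i - 1) (xu (i - 1)) (xl (i - 1)))
          (stil θu θu i (xu i))))
      - (if i = I - 1 then ctmDem θl i (xu i)
         else min (dtil θl θu i (xu i) (xu i)) (stil θl θu (i + 1) (xu (i + 1))))
  else if i < 2 * I then
    xu i + lamu (i - I) - u (i - I)
  else 0

/-- The capacity term is nonincreasing in the state and in the reference speed. -/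
theorem xi_antitone_state_speed {z z' C α vt vt' : ℝ} (hz : z ≤ z') (hC : 0 ≤ C) (hα : α ≤ 1)
    (hvt : 0 < vt) (hv : vt ≤ vt') : xi z' C α vt' ≤ xi z C α vt := by
  have hdiv : C / vt' ≤ C / vt := div_le_div_of_nonneg_left hC hvt hv
  have hαC : α * C ≤ C := mul_le_of_le_one_left hC hα
  unfold xi
  split_ifs <;> linarith

/-- The capacity term is nondecreasing in the capacity and in the drop factor. -/
theorem xi_mono_capacity {z C C' α α' vt : ℝ} (hvt : 0 < vt) (hC : 0 ≤ C) (hCC : C ≤ C')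
    (hα : 0 ≤ α) (hαα : α ≤ α') (hα1 : α ≤ 1) : xi z C α vt ≤ xi z C' α' vt := by
  have hdiv : C / vt ≤ C' / vt := by gcongr
  have hαC : α * C ≤ C := mul_le_of_le_one_left hC hα1
  have hmul : α * C ≤ α' * C' := mul_le_mul hαα hCC hC (hα.trans hαα)
  unfold xi
  split_ifs <;> linarith

theorem xi_nonneg {z C α vt : ℝ} (hC : 0 ≤ C) (hα : 0 ≤ α) : 0 ≤ xi z C α vt := by
  unfold xi
  split_ifs <;> positivity

/-- Perturbing the first argument of a minimum upwards, and the second one downwards by at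
most `k`, lowers the minimum by at most `k`. -/
theorem min_sub_le_min {a a' b b' k : ℝ} (ha : a ≤ a' + k) (hb : b - k ≤ b') :
    min a b - k ≤ min a' b' :=
  le_min (by linarith [min_le_left a b]) (by linarith [min_le_right a b])

/-- The flow supplied to a cell decreases with slope at most `w` in the state. -/
theorem supply_sub_le {w w' j j' x x' c c' : ℝ} (hw : 0 ≤ w) (hww : w ≤ w') (hj : j ≤ j')
    (hx : x ≤ x') (hcc : c ≤ c') :
    max 0 (min (w * (j - x)) c) - w * (x' - x) ≤ max 0 (min (w' * (j' - x')) c') := by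
  have hk : 0 ≤ w * (x' - x) := mul_nonneg hw (sub_nonneg.2 hx)
  have hw_le : w * (j - x') ≤ w * (j' - x') := by gcongr
  rw [sub_le_iff_le_add]
  refine max_le (by linarith [le_max_left 0 (min (w' * (j' - x')) c')]) ?_
  rw [← sub_le_iff_le_add]
  rcases le_total (j' - x') 0 with hneg | hpos
  · refine le_max_of_le_left ?_
    have := mul_nonpos_of_nonneg_of_nonpos hw hneg
    linarith [min_le_left (w * (j - x)) c]
  · have hw_mul : w * (j' - x') ≤ w' * (j' - x') := mul_le_mul_of_nonneg_right hww hpos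
    refine le_max_of_le_right (le_min ?_ ?_)
    · linarith [min_le_left (w * (j - x)) c]
    · linarith [min_le_right (w * (j - x)) c]

theorem mul_supply {b w y c : ℝ} (hb : 0 < b) :
    b * max 0 (min (w / b * y) c) = max 0 (min (w * y) (b * c)) := by
  rw [mul_max_of_nonneg _ _ hb.le, mul_min_of_nonneg _ _ hb.le, mul_zero]
  congr 2
  field_simp

/-- The decomposed demand increases with slope at most `v i` in a common state argument, and is
nonincreasing in the reference speed. -/
theorem dtil_le_add (η θ θ' : CTMParams) {i : ℕ} {x x' : ℝ} (hx : x ≤ x') (hv : 0 ≤ η.v i)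
    (hC : 0 ≤ η.C i) (hα : η.α i ≤ 1) (hθ : 0 < θ.v i) (hθθ : θ.v i ≤ θ'.v i) :
    dtil η θ' i x' x' ≤ dtil η θ i x x + η.v i * (x' - x) := by
  have hxi := xi_antitone_state_speed hx hC hα hθ hθθ
  have hk : 0 ≤ η.v i * (x' - x) := mul_nonneg hv (sub_nonneg.2 hx)
  rw [← sub_le_iff_le_add]
  exact min_sub_le_min (by linarith) (by linarith)

/-- The decomposed demand is nondecreasing in the state and in its own parameters. -/
theorem dtil_mono {θ θ' η : CTMParams} {i : ℕ} {x x' : ℝ} (z : ℝ) (hx0 : 0 ≤ x) (hx : x ≤ x')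
    (hv : 0 ≤ θ.v i) (hvv : θ.v i ≤ θ'.v i) (hη : 0 < η.v i) (hC : 0 ≤ θ.C i)
    (hCC : θ.C i ≤ θ'.C i) (hα : 0 ≤ θ.α i) (hαα : θ.α i ≤ θ'.α i) (hα1 : θ.α i ≤ 1) :
    dtil θ η i x z ≤ dtil θ' η i x' z :=
  min_le_min (mul_le_mul hvv hx hx0 (hv.trans hvv)) (xi_mono_capacity hη hC hCC hα hαα hα1)

theorem dtil_nonneg {θ η : CTMParams} {i : ℕ} {x z : ℝ} (hx : 0 ≤ x) (hv : 0 ≤ θ.v i)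
    (hC : 0 ≤ θ.C i) (hα : 0 ≤ θ.α i) : 0 ≤ dtil θ η i x z :=
  le_min (mul_nonneg hv hx) (xi_nonneg hC hα)

/-- The decomposed supply is nonincreasing in the state and in the reference split ratio. -/
theorem stil_antitone (η θ θ' : CTMParams) {i : ℕ} {x x' : ℝ} (hx : x ≤ x') (hw : 0 ≤ η.w i)
    (hβ : 0 < θ.β (i - 1)) (hββ : θ.β (i - 1) ≤ θ'.β (i - 1)) :
    stil η θ' i x' ≤ stil η θ i x := by
  have hdiv : η.w i / θ'.β (i - 1) ≤ η.w i / θ.β (i - 1) :=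
    div_le_div_of_nonneg_left hw hβ hββ
  have hdiv0 : 0 ≤ η.w i / θ'.β (i - 1) := div_nonneg hw (hβ.le.trans hββ)
  unfold stil
  rcases le_total (η.xjam i - x') 0 with hneg | hpos
  · exact max_le (le_max_left _ _) (le_max_of_le_left
      ((min_le_left _ _).trans (mul_nonpos_of_nonneg_of_nonpos hdiv0 hneg)))
  · exact max_le_max le_rfl (min_le_min
      (mul_le_mul hdiv (by linarith) hpos (hdiv0.trans hdiv)) le_rfl)

/-- The mainline inflow decreases with slope at most `w i` in the state of the receiving cell, and
is otherwise nondecreasing. -/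
theorem inflow_sub_le {θ θ' η : CTMParams} {i : ℕ} {y y' x x' : ℝ} (z : ℝ)
    (hβ : 0 < θ.β (i - 1)) (hββ : θ.β (i - 1) ≤ θ'.β (i - 1)) (hC : 0 ≤ θ.C (i - 1))
    (hCC : θ.C (i - 1) ≤ θ'.C (i - 1)) (hw : 0 ≤ θ.w i) (hww : θ.w i ≤ θ'.w i)
    (hj : θ.xjam i ≤ θ'.xjam i) (hx : x ≤ x')
    (hD0 : 0 ≤ dtil θ η (i - 1) y z) (hD : dtil θ η (i - 1) y z ≤ dtil θ' η (i - 1) y' z) :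
    θ.β (i - 1) * min (dtil θ η (i - 1) y z) (stil θ θ i x) - θ.w i * (x' - x) ≤
      θ'.β (i - 1) * min (dtil θ' η (i - 1) y' z) (stil θ' θ' i x') := by
  have hβ' := hβ.trans_le hββ
  have hk : 0 ≤ θ.w i * (x' - x) := mul_nonneg hw (sub_nonneg.2 hx)
  have hdem := mul_le_mul hββ hD hD0 hβ'.le
  unfold stil
  rw [mul_min_of_nonneg _ _ hβ.le, mul_min_of_nonneg _ _ hβ'.le, mul_supply hβ, mul_supply hβ']
  exact min_sub_le_min (by linarith)
    (supply_sub_le hw hww hj hx (mul_le_mul hββ hCC hC hβ'.le))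

/-- Proposition 1, property (M2): the embedding map is componentwise nondecreasing
jointly in its first state/demand/parameter block, under the CFL-type pairing bounds
`v_i(η) + w_i(θ) ≤ 1` and `v_i(η) + w_i(θ̃) ≤ 1`. -/
theorem ctm_M2 (I : ℕ) (hI : 2 ≤ I) (θ θt η : CTMParams)
    (hθ : θ.Admissible I) (hθt : θt.Admissible I) (hη : η.Admissible I)
    (hCFL1 : ∀ i < I, η.v i + θ.w i ≤ 1) (hCFL2 : ∀ i < I, η.v i + θt.w i ≤ 1)
    (x xt z : ℕ → ℝ) (hx0 : ∀ i < 2 * I, 0 ≤ x i) (hxt0 : ∀ i < 2 * I, 0 ≤ xt i)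
    (u lam lamt φ : ℕ → ℝ)
    (hxle : ∀ i < 2 * I, x i ≤ xt i) (hlam : ∀ i < I, lam i ≤ lamt i)
    (hθle : CTMParams.Le I θ θt) :
    ∀ i < 2 * I, ctmEmb I x z u lam φ θ η i ≤ ctmEmb I xt z u lamt φ θt η i := by
  intro i hi
  unfold ctmEmb
  by_cases hiI : i < I
  · simp only [if_pos hiI]
    obtain ⟨hv, hw, -⟩ := hθ i hiI
    obtain ⟨hvv, hww, -, -, hββ, hjj⟩ := hθle i hiI
    obtain ⟨hηv, -, hηC, ⟨-, hηα⟩, -⟩ := hη i hiI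
    obtain ⟨-, -, -, -, ⟨hβ, -⟩, -⟩ := hθ i hiI
    have hx := hxle i hi
    have hin : (if i = 0 then 0 else θ.β (i - 1) *
          min (dtil θ η (i - 1) (x (i - 1)) (z (i - 1))) (stil θ θ i (x i)))
          - θ.w i * (xt i - x i) ≤
        if i = 0 then 0 else θt.β (i - 1) *
          min (dtil θt η (i - 1) (xt (i - 1)) (z (i - 1))) (stil θt θt i (xt i)) := by
      split_ifs
      · linarith [mul_nonneg hw.le (sub_nonneg.2 hx)]
      · have hpI : i - 1 < I := by omega
        obtain ⟨pv, -, pC, ⟨pα, pα1⟩, ⟨pβ, -⟩, -⟩ := hθ _ hpI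
        obtain ⟨pvv, -, pCC, pαα, pββ, -⟩ := hθle _ hpI
        have hp0 := hx0 (i - 1) (by omega)
        exact inflow_sub_le _ pβ pββ pC.le pCC hw.le hww hjj hx
          (dtil_nonneg hp0 pv.le pC.le pα.le)
          (dtil_mono _ hp0 (hxle (i - 1) (by omega)) pv.le pvv (hη _ hpI).1 pC.le pCC
            pα.le pαα pα1)
    have hout : (if i = I - 1 then ctmDem η i (xt i) else
          min (dtil η θt i (xt i) (xt i)) (stil η θt (i + 1) (xt (i + 1)))) ≤
        (if i = I - 1 then ctmDem η i (x i) else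
          min (dtil η θ i (x i) (x i)) (stil η θ (i + 1) (x (i + 1))))
          + η.v i * (xt i - x i) := by
      split_ifs
      · exact dtil_le_add η η η hx hηv.le hηC.le hηα hηv le_rfl
      · have hnI : i + 1 < I := by omega
        have hk : 0 ≤ η.v i * (xt i - x i) := mul_nonneg hηv.le (sub_nonneg.2 hx)
        have hD := dtil_le_add η θ θt hx hηv.le hηC.le hηα hv hvv
        have hS := stil_antitone η θ θt (hxle (i + 1) (by omega)) (hη _ hnI).2.1.le hβ hββ
        rw [← sub_le_iff_le_add]
        exact min_sub_le_min hD (by linarith)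
    nlinarith [mul_nonneg (sub_nonneg.2 (hCFL1 i hiI)) (sub_nonneg.2 hx)]
  · simp only [if_neg hiI, if_pos hi]
    linarith [hxle i hi, hlam (i - I) (by omega)]
end
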